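/- Let e ∈ L be a norm-lift and let A and A′ be finite rank-1 ℤ_p[G]-modules with the same invariants: |(g−1)A| = |(g−1)A′| = p^r and |A^G| = |A′^G| = p^s with r, s ≥ 1, and there exist generators a of A and a′ of A′ and a common t ∈ {0,…,p−1} with p^s·a = e^s·(g−1)^(s(p−1))·a + t·(g−1)^r·a and p^s·a′ = e^s·(g−1)^(s(p−1))·a′ + t·(g−1)^r·a′. Then A and A′ are isomorphic as ℤ_p[G]-modules. -/

import Mathlib

noncomputable section

/-- The group algebra `ℤ_p[G]` for `G` cyclic of order `p`. -/
abbrev L (p : ℕ) [Fact p.Prime] : Type := MonoidAlgebra (PadicInt p) (Multiplicative (ZMod p))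

/-- The fixed generator `g` of `G`, viewed inside `L = ℤ_p[G]`. -/
def gL (p : ℕ) [Fact p.Prime] : L p :=
  MonoidAlgebra.of (PadicInt p) (Multiplicative (ZMod p)) (Multiplicative.ofAdd 1)

/-- The norm element `N = 1 + g + ⋯ + g^(p-1)` of `L`. -/
def NL (p : ℕ) [Fact p.Prime] : L p := ∑ i ∈ Finset.range p, gL p ^ i


/-- `e ∈ L` is a norm-lift if `p·1 = e·(g−1)^(p−1) + α·N` for some `α ∈ ℤ_p`. -/
def IsNormLift (p : ℕ) [Fact p.Prime] (e : L p) : Prop :=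
  ∃ α : PadicInt p, (p : L p) = e * (gL p - 1) ^ (p - 1) + α • NL p

/-- The submodule `(g−1)A` of an `ℤ_p[G]`-module `A`. -/
def commSub (p : ℕ) [Fact p.Prime] (A : Type) [AddCommGroup A] [Module (L p) A] :
    Submodule (L p) A :=
  LinearMap.range (LinearMap.lsmul (L p) A (gL p - 1))

/-- The fixed-point submodule `A^G = {x ∈ A : g·x = x}` of an `ℤ_p[G]`-module `A`. -/
def fixedSub (p : ℕ) [Fact p.Prime] (A : Type) [AddCommGroup A] [Module (L p) A] :
    Submodule (L p) A :=
  LinearMap.ker (LinearMap.lsmul (L p) A (gL p - 1))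

/-- An `ℤ_p[G]`-module has rank 1 if it is nonzero and generated by a single element. -/
def IsRankOne (p : ℕ) [Fact p.Prime] (A : Type) [AddCommGroup A] [Module (L p) A] : Prop :=
  Nontrivial A ∧ ∃ a : A, Submodule.span (L p) {a} = ⊤
theorem aux_gpow (p : ℕ) [Fact p.Prime] : gL p ^ p = 1 := by
  rw [gL, ← map_pow, ← ofAdd_nsmul]
  have : p • (1 : ZMod p) = 0 := by simp
  rw [this, ofAdd_zero, map_one]

theorem aux_xpow (p : ℕ) [Fact p.Prime] : ∃ q : L p, (gL p - 1) ^ p = (p : L p) * q := by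
  obtain ⟨q, hq⟩ := exists_add_pow_prime_eq (Fact.out : p.Prime) (gL p - 1) (1 : L p)
  rw [sub_add_cancel, aux_gpow] at hq
  exact ⟨-((gL p - 1) * 1 * q), by linear_combination -hq⟩

theorem aux_xp (p : ℕ) [Fact p.Prime] : ∃ q : L p,
    (gL p - 1) * (p : L p) = (gL p - 1) ^ 2 * q := by
  have h0 : (gL p - 1) * NL p = 0 := by
    rw [NL, mul_geom_sum, aux_gpow, sub_self]
  have h1 : (gL p - 1) ∣ NL p - (p : L p) := by
    have : NL p - (p : L p) = ∑ i ∈ Finset.range p, (gL p ^ i - 1) := by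
      simp [NL]
    rw [this]
    exact Finset.dvd_sum fun i _ => sub_one_dvd_pow_sub_one (gL p) i
  obtain ⟨q, hq⟩ := h1
  exact ⟨-q, by linear_combination h0 - (gL p - 1) * hq⟩

theorem aux_rep (p : ℕ) [Fact p.Prime] (k : ℕ) (l : L p) :
    ∃ (c : Fin (p ^ k)) (d m : L p), l = ((c : ℕ) : L p) + (p : L p) ^ k * d + (gL p - 1) * m := by
  have h1 : ∀ l : L p, ∃ (z : PadicInt p) (m : L p), l = algebraMap _ _ z + (gL p - 1) * m := by
    intro l
    induction l using MonoidAlgebra.induction_on with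
    | of g =>
      have : (gL p - 1) ∣ gL p ^ (g.toAdd.val) - 1 := sub_one_dvd_pow_sub_one (gL p) _
      obtain ⟨m, hm⟩ := this
      refine ⟨1, m, ?_⟩
      have h3 : (g.toAdd.val) • (1 : ZMod p) = g.toAdd := by simp
      rw [← hm, gL, ← map_pow, ← ofAdd_nsmul, h3, ofAdd_toAdd, map_one]
      ring
    | add f g hf hg =>
      obtain ⟨z, m, h⟩ := hf
      obtain ⟨z', m', h'⟩ := hg
      exact ⟨z + z', m + m', by rw [h, h', map_add]; ring⟩
    | smul r f hf =>
      obtain ⟨z, m, h⟩ := hf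
      exact ⟨r * z, algebraMap _ _ r * m, by rw [h, Algebra.smul_def, map_mul]; ring⟩
  obtain ⟨z, m, h⟩ := h1 l
  have h2 := PadicInt.appr_spec k z
  rw [Ideal.mem_span_singleton] at h2
  obtain ⟨d, hd⟩ := h2
  refine ⟨⟨z.appr k, PadicInt.appr_lt z k⟩, algebraMap _ _ d, m, ?_⟩
  have : z = (z.appr k : PadicInt p) + (p : PadicInt p) ^ k * d := by rw [← hd]; ring
  rw [h]
  conv_lhs => rw [this]
  rw [map_add, map_mul, map_pow, map_natCast, map_natCast]

theorem aux_nil (p : ℕ) [Fact p.Prime] (A : Type) [AddCommGroup A] [Module (L p) A] [Finite A]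
    (r : ℕ) (hcr : Nat.card (commSub p A) = p ^ r) (a : A) : (gL p - 1) ^ (r + 1) • a = 0 := by
  set x := gL p - 1 with hx
  have hp : p.Prime := Fact.out
  have hpr : ∀ b : A, (p : L p) ^ r • x • b = 0 := by
    intro b
    have hb : x • b ∈ commSub p A := ⟨b, rfl⟩
    have h := card_nsmul_eq_zero' (x := (⟨x • b, hb⟩ : commSub p A))
    rw [hcr] at h
    have h' := congrArg Subtype.val h
    simp only [Submodule.coe_smul, Submodule.coe_zero] at h'
    rw [← Nat.cast_pow, Nat.cast_smul_eq_nsmul]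
    exact h'
  obtain ⟨q, hq⟩ := aux_xpow p
  have hnil : ∀ b : A, x ^ (p * r + 1) • b = 0 := by
    intro b
    have : x ^ (p * r + 1) = q ^ r * ((p : L p) ^ r * x) := by
      rw [pow_succ, pow_mul, hx, hq]; ring
    rw [this, mul_smul, mul_smul, hpr, smul_zero]
  let C : ℕ → Submodule (L p) A := fun k => LinearMap.range (LinearMap.lsmul (L p) A (x ^ (k + 1)))
  have hC : ∀ k b, b ∈ C k ↔ ∃ c, x ^ (k + 1) • c = b := fun k b => Iff.rfl
  have hle : ∀ k, C (k + 1) ≤ C k := by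
    intro k b hb
    obtain ⟨c, rfl⟩ := (hC _ _).1 hb
    exact (hC _ _).2 ⟨x • c, by rw [smul_smul]; rfl⟩
  have hbot : ∀ k, C (k + 1) = C k → C k = ⊥ := by
    intro k hk
    have h : ∀ j, C k ≤ C (k + j) := by
      intro j
      induction j with
      | zero => exact le_rfl
      | succ j ih =>
        intro b hb
        rw [← hk] at hb
        obtain ⟨c, rfl⟩ := (hC _ _).1 hb
        obtain ⟨d, hd⟩ := (hC _ _).1 (ih ((hC k _).2 ⟨c, rfl⟩))
        refine (hC _ _).2 ⟨d, ?_⟩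
        rw [pow_succ' x (k + 1), mul_smul, ← hd, smul_smul, ← pow_succ']
        rfl
    rw [eq_bot_iff]
    intro b hb
    obtain ⟨c, rfl⟩ := (hC _ _).1 (h (p * r) hb)
    have : x ^ (k + p * r + 1) = x ^ k * x ^ (p * r + 1) := by ring
    rw [this, mul_smul, hnil, smul_zero]
    exact Submodule.zero_mem _
  have hcard : ∀ k, Nat.card (C k) ∣ p ^ (r - k) := by
    intro k
    induction k with
    | zero =>
      have : C 0 = commSub p A := by simp [C, commSub, hx]
      rw [this, hcr]; simp
    | succ k ih =>
      by_cases hk : C (k + 1) = C k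
      · rw [hk, hbot k hk]; simp
      · have hd : Nat.card (C (k + 1)) ∣ Nat.card (C k) :=
          AddSubgroup.card_dvd_of_le (H := (C (k+1)).toAddSubgroup) (K := (C k).toAddSubgroup) (hle k)
        have hne : Nat.card (C (k + 1)) ≠ Nat.card (C k) := by
          intro h
          apply hk
          apply SetLike.coe_injective
          exact Set.eq_of_subset_of_ncard_le (hle k) (le_of_eq h.symm) (Set.toFinite _)
        obtain ⟨j, hj, hj'⟩ := (Nat.dvd_prime_pow hp).1 ih
        rw [hj'] at hd hne
        obtain ⟨i, hi, hi'⟩ := (Nat.dvd_prime_pow hp).1 hd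
        rw [hi'] at hne ⊢
        have : i ≠ j := fun h => hne (by rw [h])
        exact pow_dvd_pow _ (by omega)
  have h := hcard r
  simp only [Nat.sub_self, pow_zero, Nat.dvd_one] at h
  have hm : x ^ (r + 1) • a ∈ C r := (hC _ _).2 ⟨a, rfl⟩
  have hs : Subsingleton (C r) := (Nat.card_eq_one_iff_unique.1 h).1
  have := Subsingleton.elim (⟨_, hm⟩ : C r) 0
  exact congrArg Subtype.val this

theorem aux_card (p : ℕ) [Fact p.Prime] (r s : ℕ) (J : Ideal (L p)) (u : L p)
    (h1 : (gL p - 1) ^ (r + 1) ∈ J) (h2 : (p : L p) ^ s - (gL p - 1) * u ∈ J) :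
    Finite (L p ⧸ J) ∧ Nat.card (L p ⧸ J) ≤ p ^ s * p ^ r := by
  obtain ⟨q, hq⟩ := aux_xp p
  set x := gL p - 1 with hx
  have step : ∀ m : L p, ∃ (c : Fin p) (m' : L p), x * m = x * ((c : ℕ) : L p) + x ^ 2 * m' := by
    intro m
    obtain ⟨c, d, m', h⟩ := aux_rep p 1 m
    refine ⟨⟨c, by have := c.2; simpa using this⟩, q * d + m', ?_⟩
    rw [h]
    simp only [← hx]
    linear_combination d * hq
  choose C M hCM using step
  have key : ∀ (m : L p) (n : ℕ), x * m =
      ∑ i ∈ Finset.range n, ((C (M^[i] m) : ℕ) : L p) * x ^ (i + 1) + x ^ (n + 1) * M^[n] m := by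
    intro m n
    induction n with
    | zero => simp
    | succ n ih =>
      rw [Finset.sum_range_succ, Function.iterate_succ_apply', ih]
      linear_combination x ^ n * hCM (M^[n] m)
  let φ : Fin (p ^ s) × (Fin r → Fin p) → L p ⧸ J := fun v =>
    Ideal.Quotient.mk J (((v.1 : ℕ) : L p) + ∑ i : Fin r, ((v.2 i : ℕ) : L p) * x ^ ((i : ℕ) + 1))
  have hφ : Function.Surjective φ := by
    intro b
    obtain ⟨l, rfl⟩ := Ideal.Quotient.mk_surjective b
    obtain ⟨c, d, m, h⟩ := aux_rep p s l
    refine ⟨(c, fun i => C (M^[i] (m + u * d))), ?_⟩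
    have k := key (m + u * d) r
    rw [Finset.sum_range] at k
    refine (Ideal.Quotient.eq.2 ?_).symm
    have : l - (((c : ℕ) : L p) + ∑ i : Fin r, ((C (M^[i] (m + u * d)) : ℕ) : L p) * x ^ ((i : ℕ) + 1))
      = d * ((p : L p) ^ s - x * u) + (M^[r] (m + u * d)) * x ^ (r + 1) := by
      rw [h]
      linear_combination k
    rw [this]
    exact J.add_mem (J.mul_mem_left _ h2) (J.mul_mem_left _ h1)
  refine ⟨Finite.of_surjective φ hφ, ?_⟩
  refine (Nat.card_le_card_of_surjective φ hφ).trans ?_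
  simp

theorem aux_main (p : ℕ) [Fact p.Prime] (A : Type) [AddCommGroup A] [Module (L p) A] [Finite A]
    (r s : ℕ) (u : L p)
    (hcr : Nat.card (commSub p A) = p ^ r) (hcs : Nat.card (fixedSub p A) = p ^ s)
    (a : A) (ha : Submodule.span (L p) {a} = ⊤)
    (hu : (p : L p) ^ s • a = ((gL p - 1) * u) • a) :
    Nonempty ((L p ⧸ (Ideal.span {(gL p - 1) ^ (r + 1), (p : L p) ^ s - (gL p - 1) * u})) ≃ₗ[L p] A) := by
  set J : Ideal (L p) := Ideal.span {(gL p - 1) ^ (r + 1), (p : L p) ^ s - (gL p - 1) * u} with hJ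
  obtain ⟨hfin, hle⟩ := aux_card p r s J u (Ideal.subset_span (by simp)) (Ideal.subset_span (by simp))
  have hker : J ≤ LinearMap.ker (LinearMap.toSpanSingleton (L p) A a) := by
    rw [hJ, Ideal.span_le]
    rintro y (rfl | rfl)
    · simpa using aux_nil p A r hcr a
    · simp [sub_smul, hu]
  let ψ : (L p ⧸ J) →ₗ[L p] A := Submodule.liftQ J (LinearMap.toSpanSingleton (L p) A a) hker
  have hsurj : Function.Surjective ψ := by
    intro b
    have hb : b ∈ Submodule.span (L p) {a} := by rw [ha]; trivial
    obtain ⟨l, rfl⟩ := Submodule.mem_span_singleton.1 hb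
    exact ⟨Submodule.Quotient.mk l, Submodule.liftQ_apply _ _ _⟩
  have hA : Nat.card A = p ^ s * p ^ r := by
    let f := LinearMap.lsmul (L p) A (gL p - 1)
    have h1 : Nat.card A = Nat.card (A ⧸ LinearMap.ker f) * Nat.card (LinearMap.ker f) :=
      AddSubgroup.card_eq_card_quotient_mul_card_addSubgroup (LinearMap.ker f).toAddSubgroup
    rw [Nat.card_congr f.quotKerEquivRange.toEquiv] at h1
    rw [h1, ← hcr, ← hcs, mul_comm]
    rfl
  have hc : Nat.card (L p ⧸ J) = Nat.card A :=
    le_antisymm (hA ▸ hle) (Nat.card_le_card_of_surjective ψ hsurj)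
  have hb : Function.Bijective ψ := (Nat.bijective_iff_surjective_and_card ψ).2 ⟨hsurj, hc⟩
  exact ⟨LinearEquiv.ofBijective ψ hb⟩

/-- two finite rank-1 `ℤ_p[G]`-modules with the same invariants `r, s ≥ 1` and
`t ∈ {0,…,p−1}` (w.r.t. a norm-lift `e`) are isomorphic as `ℤ_p[G]`-modules. -/
theorem stmt_8 (p : ℕ) [Fact p.Prime] (e : L p) (he : IsNormLift p e)
    (A A' : Type) [AddCommGroup A] [Module (L p) A] [Finite A]
    [AddCommGroup A'] [Module (L p) A'] [Finite A']
    (hA : IsRankOne p A) (hA' : IsRankOne p A')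
    (r s : ℕ) (hr : 1 ≤ r) (hs : 1 ≤ s)
    (hcr : Nat.card (commSub p A) = p ^ r) (hcr' : Nat.card (commSub p A') = p ^ r)
    (hcs : Nat.card (fixedSub p A) = p ^ s) (hcs' : Nat.card (fixedSub p A') = p ^ s)
    (t : ℕ) (htp : t < p)
    (a : A) (ha : Submodule.span (L p) {a} = ⊤)
    (a' : A') (ha' : Submodule.span (L p) {a'} = ⊤)
    (ht : (p : L p) ^ s • a
      = (e ^ s * (gL p - 1) ^ (s * (p - 1))) • a + ((t : L p) * (gL p - 1) ^ r) • a)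
    (ht' : (p : L p) ^ s • a'
      = (e ^ s * (gL p - 1) ^ (s * (p - 1))) • a' + ((t : L p) * (gL p - 1) ^ r) • a') :
    Nonempty (A ≃ₗ[L p] A') := by
  have hp1 : 1 ≤ p - 1 := by
    have := (Fact.out : p.Prime).two_le
    omega
  have hk : 1 ≤ s * (p - 1) := Nat.mul_pos hs hp1
  let u : L p := e ^ s * (gL p - 1) ^ (s * (p - 1) - 1) + (t : L p) * (gL p - 1) ^ (r - 1)
  have hu : (gL p - 1) * u = e ^ s * (gL p - 1) ^ (s * (p - 1)) + (t : L p) * (gL p - 1) ^ r := by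
    obtain ⟨k, hk'⟩ := Nat.exists_eq_add_of_le hk
    obtain ⟨r', hr'⟩ := Nat.exists_eq_add_of_le hr
    simp only [u]
    rw [hk', hr', Nat.add_sub_cancel_left, Nat.add_sub_cancel_left]
    ring
  obtain ⟨E⟩ := aux_main p A r s u hcr hcs a ha (by rw [ht, hu, add_smul])
  obtain ⟨E'⟩ := aux_main p A' r s u hcr' hcs' a' ha' (by rw [ht', hu, add_smul])
  exact ⟨E.symm.trans E'⟩
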